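/- Let l ≥ 2 and h ≥ 1 be integers, let G be an ordered graph, and let f_1, f_2, …, f_{h+1} be edges of G such that for every 1 ≤ i ≤ h there is a bordered cycle of length 2l in G whose outer border is f_i and whose inner border is f_{i+1}. Then G contains a bordered cycle of length 2(h(l−1)+1) whose outer border is f_1 and whose inner border is f_{h+1}. -/

import Mathlib

/-- `HasBorderedCycleWith G l outer inner` says that the ordered graph `G` (a simple graph on a
linearly ordered vertex set) contains a bordered cycle of length `2 * l` whose outer border is
the pair `outer` and whose inner border is the pair `inner`.  That is, there are vertices
`u 0 < u 1 < ⋯ < u (l-1) < v 0 < v 1 < ⋯ < v (l-1)` and a cycle of length `2 * l` in `G` on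
these `2 * l` vertices, every edge of which joins some `u i` to some `v j`, such that both the
pair `{u 0, v (l-1)}` (the outer border) and the pair `{u (l-1), v 0}` (the inner border) are
edges of the cycle; moreover `outer = {u 0, v (l-1)}` and `inner = {u (l-1), v 0}`.
Since every edge of the cycle joins a `u i` to a `v j`, the cycle alternates between the `u`'s
and the `v`'s, so it can be encoded by a pair of permutations `a b` of `Fin l`: the cycle
visits `u (a 0), v (b 0), u (a 1), v (b 1), …, u (a (l-1)), v (b (l-1))` and returns to
`u (a 0)`.  Its edges are thus the pairs `{u (a s), v (b s)}` and `{u (a (s+1)), v (b s)}`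
(with `s + 1` taken cyclically in `Fin l`). -/
def HasBorderedCycleWith {V : Type*} [LinearOrder V] (G : SimpleGraph V) (l : ℕ)
    (outer inner : Sym2 V) : Prop :=
  ∃ m : ℕ, l = m + 2 ∧ ∃ (u v : Fin (m + 2) → V) (a b : Equiv.Perm (Fin (m + 2))),
    StrictMono u ∧ StrictMono v ∧ u (Fin.last (m + 1)) < v 0 ∧
    (∀ s, G.Adj (u (a s)) (v (b s))) ∧
    (∀ s, G.Adj (u (a (s + 1))) (v (b s))) ∧
    (∃ s, (a s = 0 ∧ b s = Fin.last (m + 1)) ∨ (a (s + 1) = 0 ∧ b s = Fin.last (m + 1))) ∧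
    (∃ s, (a s = Fin.last (m + 1) ∧ b s = 0) ∨ (a (s + 1) = Fin.last (m + 1) ∧ b s = 0)) ∧
    outer = s(u 0, v (Fin.last (m + 1))) ∧ inner = s(u (Fin.last (m + 1)), v 0)

/-- The ordered graph `G` contains a bordered cycle of length `2 * l`. -/
def HasBorderedCycle {V : Type*} [LinearOrder V] (G : SimpleGraph V) (l : ℕ) : Prop :=
  ∃ outer inner, HasBorderedCycleWith G l outer inner

/-- The pairs `(s, t)` such that the `s`-th vertex of one side and the `t`-th vertex of the other
side are consecutive on an alternating cycle `x 0, y 0, x 1, y 1, …` of length `2 * (m + 2)`. -/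
def AlternatingAdj {m : ℕ} (s t : Fin (m + 2)) : Prop := s = t ∨ s = t + 1

theorem alternatingAdj_iff_val {m : ℕ} (s t : Fin (m + 2)) :
    AlternatingAdj s t ↔ (s : ℕ) = t ∨ (s : ℕ) = t + 1 ∨ ((s : ℕ) = 0 ∧ (t : ℕ) = m + 1) := by
  unfold AlternatingAdj
  rw [Fin.ext_iff, Fin.ext_iff, Fin.val_add_one]
  have := s.isLt
  split_ifs with h
  · have : (t : ℕ) = m + 1 := by simp [h]
    omega
  · have : (t : ℕ) ≠ m + 1 := fun h' => h (Fin.ext h')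
    omega

/-- The alternating closed walk `x 0, y 0, x 1, y 1, …` is a bordered cycle of `G` with outer
border `{a, d}` and inner border `{b, c}`, where `a < b < c < d`. -/
structure IsBorderedCycle {V : Type*} [LinearOrder V] (G : SimpleGraph V) {m : ℕ}
    (x y : Fin (m + 2) → V) (a b c d : V) : Prop where
  injective_left : Function.Injective x
  injective_right : Function.Injective y
  lt : ∀ i j, x i < y j
  adj : ∀ s t, AlternatingAdj s t → G.Adj (x s) (y t)
  outer : ∃ s t, AlternatingAdj s t ∧ x s = a ∧ y t = d
  inner : ∃ s t, AlternatingAdj s t ∧ x s = b ∧ y t = c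
  left_ge : ∀ i, a ≤ x i
  left_le : ∀ i, x i ≤ b
  right_ge : ∀ i, c ≤ y i
  right_le : ∀ i, y i ≤ d

theorem exists_strictMono_comp_perm {V : Type*} [LinearOrder V] {n : ℕ} {x : Fin n → V}
    (hx : Function.Injective x) :
    ∃ (u : Fin n → V) (e : Equiv.Perm (Fin n)), StrictMono u ∧ ∀ i, u (e i) = x i :=
  ⟨x ∘ Tuple.sort x, (Tuple.sort x).symm,
    (Tuple.monotone_sort x).strictMono_of_injective (hx.comp (Tuple.sort x).injective),
    fun i => by simp⟩

theorem HasBorderedCycleWith.exists_isBorderedCycle {V : Type*} [LinearOrder V]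
    {G : SimpleGraph V} {l : ℕ} {o i : Sym2 V} (H : HasBorderedCycleWith G l o i) :
    ∃ m, l = m + 2 ∧ ∃ (x y : Fin (m + 2) → V) (a b c d : V),
      IsBorderedCycle G x y a b c d ∧ o = s(a, d) ∧ i = s(b, c) := by
  obtain ⟨m, rfl, u, v, e, e', hu, hv, huv, h1, h2, ⟨s, hs⟩, ⟨t, ht⟩, rfl, rfl⟩ := H
  refine ⟨m, rfl, u ∘ e, v ∘ e', _, _, _, _, ?_, rfl, rfl⟩
  refine ⟨hu.injective.comp e.injective, hv.injective.comp e'.injective, fun i j => ?_, ?_, ?_, ?_,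
    fun i => hu.monotone (Fin.zero_le _), fun i => hu.monotone (Fin.le_last _),
    fun i => hv.monotone (Fin.zero_le _), fun i => hv.monotone (Fin.le_last _)⟩
  · exact (hu.monotone (Fin.le_last _)).trans_lt (huv.trans_le (hv.monotone (Fin.zero_le _)))
  · rintro s t (rfl | rfl)
    · exact h1 _
    · exact h2 _
  · rcases hs with hs | hs
    · exact ⟨s, s, Or.inl rfl, by simp [hs.1], by simp [hs.2]⟩
    · exact ⟨s + 1, s, Or.inr rfl, by simp [hs.1], by simp [hs.2]⟩
  · rcases ht with hs | hs
    · exact ⟨t, t, Or.inl rfl, by simp [hs.1], by simp [hs.2]⟩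
    · exact ⟨t + 1, t, Or.inr rfl, by simp [hs.1], by simp [hs.2]⟩

namespace IsBorderedCycle

variable {V : Type*} [LinearOrder V] {G : SimpleGraph V} {m : ℕ} {x y : Fin (m + 2) → V}
  {a b c d : V}

theorem hasBorderedCycleWith (H : IsBorderedCycle G x y a b c d) :
    HasBorderedCycleWith G (m + 2) s(a, d) s(b, c) := by
  obtain ⟨u, e, hu, hue⟩ := exists_strictMono_comp_perm H.injective_left
  obtain ⟨v, e', hv, hve⟩ := exists_strictMono_comp_perm H.injective_right
  obtain ⟨s, t, hst, rfl, rfl⟩ := H.outer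
  obtain ⟨s', t', hst', rfl, rfl⟩ := H.inner
  have es : e s = 0 := le_antisymm
    (hu.le_iff_le.1 (by simpa [← hue] using H.left_ge (e.symm 0))) (Fin.zero_le _)
  have es' : e s' = Fin.last _ := le_antisymm (Fin.le_last _)
    (hu.le_iff_le.1 (by simpa [← hue] using H.left_le (e.symm (Fin.last _))))
  have et : e' t = Fin.last _ := le_antisymm (Fin.le_last _)
    (hv.le_iff_le.1 (by simpa [← hve] using H.right_le (e'.symm (Fin.last _))))
  have et' : e' t' = 0 := le_antisymm
    (hv.le_iff_le.1 (by simpa [← hve] using H.right_ge (e'.symm 0))) (Fin.zero_le _)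
  refine ⟨m, rfl, u, v, e, e', hu, hv, ?_, ?_, ?_, ?_, ?_, ?_, ?_⟩
  · rw [← es', ← et', hue, hve]; exact H.lt _ _
  · intro s; rw [hue, hve]; exact H.adj _ _ (Or.inl rfl)
  · intro s; rw [hue, hve]; exact H.adj _ _ (Or.inr rfl)
  · rcases hst with rfl | rfl
    exacts [⟨_, Or.inl ⟨es, et⟩⟩, ⟨_, Or.inr ⟨es, et⟩⟩]
  · rcases hst' with rfl | rfl
    exacts [⟨_, Or.inl ⟨es', et'⟩⟩, ⟨_, Or.inr ⟨es', et'⟩⟩]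
  · rw [← es, ← et, hue, hve]
  · rw [← es', ← et', hue, hve]

theorem reindex (H : IsBorderedCycle G x y a b c d) (σ τ : Equiv.Perm (Fin (m + 2)))
    (h : ∀ s t, AlternatingAdj (σ s) (τ t) ↔ AlternatingAdj s t) :
    IsBorderedCycle G (x ∘ σ) (y ∘ τ) a b c d where
  injective_left := H.injective_left.comp σ.injective
  injective_right := H.injective_right.comp τ.injective
  lt _ _ := H.lt _ _
  adj s t hst := H.adj _ _ ((h s t).2 hst)
  outer := by
    obtain ⟨s, t, hst, h1, h2⟩ := H.outer
    exact ⟨σ.symm s, τ.symm t, by rw [← h]; simpa using hst, by simpa using h1, by simpa using h2⟩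
  inner := by
    obtain ⟨s, t, hst, h1, h2⟩ := H.inner
    exact ⟨σ.symm s, τ.symm t, by rw [← h]; simpa using hst, by simpa using h1, by simpa using h2⟩
  left_ge _ := H.left_ge _
  left_le _ := H.left_le _
  right_ge _ := H.right_ge _
  right_le _ := H.right_le _

theorem rotate (H : IsBorderedCycle G x y a b c d) (k : Fin (m + 2)) :
    IsBorderedCycle G (fun i => x (i + k)) (fun i => y (i + k)) a b c d :=
  H.reindex (Equiv.addRight k) (Equiv.addRight k) fun s t => by
    simp [AlternatingAdj, add_right_comm t k 1]

theorem reflect (H : IsBorderedCycle G x y a b c d) :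
    IsBorderedCycle G (fun i => x (-i)) (fun i => y (-i - 1)) a b c d :=
  H.reindex (Equiv.neg _) ((Equiv.neg _).trans (Equiv.subRight 1)) fun s t => by
    have h : -s = -t - 1 ↔ s = t + 1 := by rw [← neg_add', neg_inj]
    simp [AlternatingAdj, h, or_comm]

/-- Relabel a bordered cycle so that a given edge `{x s, y t}` becomes `{x 0, y 0}`. -/
theorem exists_zero_zero (H : IsBorderedCycle G x y a b c d) {s t : Fin (m + 2)}
    (hst : AlternatingAdj s t) :
    ∃ x' y' : Fin (m + 2) → V, IsBorderedCycle G x' y' a b c d ∧ x' 0 = x s ∧ y' 0 = y t := by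
  rcases hst with rfl | rfl
  · exact ⟨_, _, H.rotate s, by simp, by simp⟩
  · exact ⟨_, _, H.reflect.rotate (-t - 1), by simp [add_comm], by simp⟩

/-- Relabel a bordered cycle so that a given edge `{x s, y t}` becomes the closing edge
`{x 0, y (m + 1)}`. -/
theorem exists_zero_last (H : IsBorderedCycle G x y a b c d) {s t : Fin (m + 2)}
    (hst : AlternatingAdj s t) :
    ∃ x' y' : Fin (m + 2) → V, IsBorderedCycle G x' y' a b c d ∧ x' 0 = x s ∧
      y' (Fin.last (m + 1)) = y t := by
  have hlast : Fin.last (m + 1) = -1 := by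
    rw [eq_neg_iff_add_eq_zero]; exact Fin.last_add_one _
  obtain ⟨x', y', H', h1, h2⟩ := H.exists_zero_zero hst
  exact ⟨_, _, H'.reflect, by simpa using h1, by simpa [hlast] using h2⟩

theorem left_ne (H : IsBorderedCycle G x y a b c d) : a ≠ b := fun h =>
  absurd (H.injective_left (((H.left_le 0).trans (h ▸ H.left_ge 1)).antisymm
    ((H.left_le 1).trans (h ▸ H.left_ge 0)))) (by simp)

/-- Cut the first cycle at its inner border and the second one at its outer border, and join the
resulting paths. -/
theorem glue_aux {n : ℕ} {x' y' : Fin (n + 2) → V} {b' c' : V}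
    (H : IsBorderedCycle G x y a b c d) (H' : IsBorderedCycle G x' y' b b' c' c)
    (hx : x 0 = b) (hy : y (Fin.last (m + 1)) = c) (hx' : x' 0 = b) (hy' : y' 0 = c) :
    IsBorderedCycle G (m := m + n + 1)
      (fun i => if h : (i : ℕ) < m + 2 then x ⟨i, h⟩ else x' ⟨i - (m + 1), by omega⟩)
      (fun i => if h : (i : ℕ) < m + 2 then y ⟨i, h⟩ else y' ⟨i - (m + 1), by omega⟩)
      a b' c' d := by
  have hab : a ≤ b := hx ▸ H.left_ge 0
  have hcd : c ≤ d := hy ▸ H.right_le _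
  have hbb : b ≤ b' := hx' ▸ H'.left_le 0
  have hcc : c' ≤ c := hy' ▸ H'.right_ge 0
  have hlt : ∀ j (hj : j < n + 2), j ≠ 0 → b < x' ⟨j, hj⟩ := fun j hj h0 =>
    lt_of_le_of_ne (H'.left_ge _) fun h => h0 (by
      simpa using congrArg Fin.val (H'.injective_left (h.symm.trans hx'.symm)))
  have hgt : ∀ j (hj : j < n + 2), j ≠ 0 → y' ⟨j, hj⟩ < c := fun j hj h0 =>
    lt_of_le_of_ne (H'.right_le _) fun h => h0 (by
      simpa using congrArg Fin.val (H'.injective_right (h.trans hy'.symm)))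
  refine ⟨?_, ?_, ?_, ?_, ?_, ?_, ?_, ?_, ?_, ?_⟩
  · intro i j hij
    dsimp only at hij
    split_ifs at hij with hi hj hj
    · simpa [Fin.ext_iff] using H.injective_left hij
    · exact absurd hij ((H.left_le _).trans_lt (hlt _ _ (by omega))).ne
    · exact absurd hij ((H.left_le _).trans_lt (hlt _ _ (by omega))).ne'
    · have := congrArg Fin.val (H'.injective_left hij)
      simp only at this
      omega
  · intro i j hij
    dsimp only at hij
    split_ifs at hij with hi hj hj
    · simpa [Fin.ext_iff] using H.injective_right hij
    · exact absurd hij ((hgt _ _ (by omega)).trans_le (H.right_ge _)).ne'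
    · exact absurd hij ((hgt _ _ (by omega)).trans_le (H.right_ge _)).ne
    · have := congrArg Fin.val (H'.injective_right hij)
      simp only at this
      omega
  · intro i j
    split_ifs with hi hj hj
    · exact H.lt _ _
    · exact (H.left_le _).trans_lt (hx' ▸ H'.lt _ _)
    · exact (hy' ▸ H'.lt _ _ : _ < c).trans_le (H.right_ge _)
    · exact H'.lt _ _
  · intro s t hst
    rw [alternatingAdj_iff_val] at hst
    have hs := s.isLt
    have ht := t.isLt
    split_ifs with h1 h2 h2
    · rcases hst with h | h | h
      · exact H.adj _ _ ((alternatingAdj_iff_val _ _).2 (Or.inl h))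
      · exact H.adj _ _ ((alternatingAdj_iff_val _ _).2 (Or.inr (Or.inl h)))
      · omega
    · have : (⟨s, h1⟩ : Fin (m + 2)) = 0 := Fin.ext (by simp only [Fin.val_zero]; omega)
      rw [this, hx, ← hx']
      refine H'.adj _ _ ((alternatingAdj_iff_val _ _).2 ?_)
      simp only [Fin.val_zero, true_and]
      omega
    · have : (⟨t, h2⟩ : Fin (m + 2)) = Fin.last _ := Fin.ext (by simp only [Fin.val_last]; omega)
      rw [this, hy, ← hy']
      refine H'.adj _ _ ((alternatingAdj_iff_val _ _).2 ?_)
      simp only [Fin.val_zero]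
      omega
    · refine H'.adj _ _ ((alternatingAdj_iff_val _ _).2 ?_)
      simp only
      omega
  · obtain ⟨s, t, hst, rfl, rfl⟩ := H.outer
    have hs0 : (s : ℕ) ≠ 0 := fun h => H.left_ne (by rw [← hx, Fin.ext (a := s) (b := 0) h])
    rw [alternatingAdj_iff_val] at hst
    refine ⟨⟨s, by omega⟩, ⟨t, by omega⟩, (alternatingAdj_iff_val _ _).2 ?_, by simp, by simp⟩
    simp only
    omega
  · obtain ⟨s, t, hst, rfl, rfl⟩ := H'.inner
    have hs0 : (s : ℕ) ≠ 0 := fun h => H'.left_ne (by rw [← hx', Fin.ext (a := s) (b := 0) h])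
    have hs := s.isLt
    have ht := t.isLt
    rw [alternatingAdj_iff_val] at hst
    by_cases ht0 : (t : ℕ) = 0
    · refine ⟨⟨m + 1 + s, by omega⟩, ⟨m + 1, by omega⟩, (alternatingAdj_iff_val _ _).2 ?_, ?_, ?_⟩
      · simp only
        omega
      · rw [dif_neg (by simp only; omega)]
        congr 1
        ext
        simp
      · rw [dif_pos (by simp only; omega)]
        obtain rfl : t = 0 := Fin.ext ht0
        exact hy.trans hy'.symm
    · refine ⟨⟨m + 1 + s, by omega⟩, ⟨m + 1 + t, by omega⟩,
        (alternatingAdj_iff_val _ _).2 ?_, ?_, ?_⟩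
      · simp only
        omega
      · rw [dif_neg (by simp only; omega)]
        congr 1
        ext
        simp
      · rw [dif_neg (by simp only; omega)]
        congr 1
        ext
        simp
  all_goals intro i; split_ifs
  · exact H.left_ge _
  · exact hab.trans (H'.left_ge _)
  · exact (H.left_le _).trans hbb
  · exact H'.left_le _
  · exact hcc.trans (H.right_ge _)
  · exact H'.right_ge _
  · exact H.right_le _
  · exact (H'.right_le _).trans hcd

end IsBorderedCycle

theorem HasBorderedCycleWith.glue {V : Type*} [LinearOrder V] {G : SimpleGraph V} {p q : ℕ}
    {e f g : Sym2 V} (H : HasBorderedCycleWith G (p + 1) e f)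
    (H' : HasBorderedCycleWith G (q + 1) f g) : HasBorderedCycleWith G (p + q + 1) e g := by
  obtain ⟨m, hm, x, y, a, b, c, d, C, rfl, rfl⟩ := H.exists_isBorderedCycle
  obtain ⟨n, hn, x', y', a', b', c', d', C', h, rfl⟩ := H'.exists_isBorderedCycle
  obtain ⟨s, t, hst, hs, ht⟩ := C.inner
  obtain ⟨s', t', hst', hs', ht'⟩ := C'.outer
  have h_lt : b < c := hs ▸ ht ▸ C.lt s t
  have h_lt' : a' < d' := hs' ▸ ht' ▸ C'.lt s' t'
  obtain ⟨rfl, rfl⟩ : b = a' ∧ c = d' := by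
    rcases Sym2.eq_iff.1 h with h | ⟨rfl, rfl⟩
    · exact h
    · exact absurd h_lt h_lt'.not_gt
  obtain ⟨z, w, D, hz, hw⟩ := C.exists_zero_last hst
  obtain ⟨z', w', D', hz', hw'⟩ := C'.exists_zero_zero hst'
  have := (D.glue_aux D' (hz.trans hs) (hw.trans ht) (hz'.trans hs')
    (hw'.trans ht')).hasBorderedCycleWith
  rwa [show p + q + 1 = m + n + 1 + 2 by omega]

/-- **Gluing bordered cycles.** Let `l ≥ 2`, `h ≥ 1`, and let `f 1, …, f (h + 1)` be edges of
the ordered graph `G` such that for every `1 ≤ i ≤ h` there is a bordered cycle of length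
`2 * l` in `G` with outer border `f i` and inner border `f (i + 1)`.  Then `G` contains a
bordered cycle of length `2 * (h * (l - 1) + 1)` with outer border `f 1` and inner border
`f (h + 1)`. -/
theorem bordered_cycles_glue {V : Type*} [LinearOrder V] (l h : ℕ) (hl : 2 ≤ l) (hh : 1 ≤ h)
    (G : SimpleGraph V) (f : ℕ → Sym2 V)
    (hedge : ∀ i, 1 ≤ i → i ≤ h + 1 → f i ∈ G.edgeSet)
    (hcyc : ∀ i, 1 ≤ i → i ≤ h → HasBorderedCycleWith G l (f i) (f (i + 1))) :
    HasBorderedCycleWith G (h * (l - 1) + 1) (f 1) (f (h + 1)) := by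
  obtain ⟨k, rfl⟩ : ∃ k, l = k + 1 := ⟨l - 1, by omega⟩
  induction h, hh using Nat.le_induction with
  | base => simpa using hcyc 1 le_rfl le_rfl
  | succ h hh ih =>
    have h1 := ih (fun i hi hi' => hedge i hi (by omega)) fun i hi hi' => hcyc i hi (by omega)
    have h2 := h1.glue (hcyc (h + 1) (by omega) le_rfl)
    simpa [Nat.succ_mul] using h2
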